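/- Let Γ=(G,v₀,𝓛) be an edge-symmetric terminal game and v a position with two distinct terminal out-neighbors x,y∈V_T controlled by player i(v). Then: (a) if 𝓛^{i(v)}(x) < 𝓛^{i(v)}(y), then no uniform Nash equilibrium σ of Γ has σ(v)=y; and (b) if 𝓛^{i(v)}(x) = 𝓛^{i(v)}(y) and σ' is a uniform Nash equilibrium of the game Γ' obtained from Γ by deleting the edge (v,y), then σ' is a uniform Nash equilibrium of Γ. -/

import Mathlib

open scoped Classical

section CoreDefs

variable {V : Type}

/-- A position is terminal iff it has no outgoing edges. -/
def Terminal (E : V → V → Prop) (v : V) : Prop := ∀ u, ¬ E v u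

/-- A situation (profile of pure stationary strategies), encoded as a single
successor map: at every non-terminal position it must follow an edge. -/
def IsSituation (E : V → V → Prop) (s : V → V) : Prop :=
  ∀ v, ¬ Terminal E v → E v (s v)

/-- `s'` is a unilateral deviation of player `i` from `s`: they agree at every
position not controlled by `i` (terminals are controlled by nobody). -/
def Deviation {n : ℕ} (E : V → V → Prop) (owner : V → Fin n) (i : Fin n)
    (s s' : V → V) : Prop :=
  ∀ v, (owner v ≠ i ∨ Terminal E v) → s' v = s v

/-- The play of `s` started at `v` reaches a terminal position. -/
def Reaches (E : V → V → Prop) (s : V → V) (v : V) : Prop :=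
  ∃ k, Terminal E (s^[k] v)

/-- First time the play of `s` from `v` is at a terminal position. -/
noncomputable def stopTime (E : V → V → Prop) (s : V → V) (v : V) : ℕ :=
  sInf {k | Terminal E (s^[k] v)}

/-- The terminal position reached by the play of `s` from `v` (junk if none). -/
noncomputable def playEnd (E : V → V → Prop) (s : V → V) (v : V) : V :=
  s^[stopTime E s v] v

/-- Effective cost in a terminal game: the cost of the terminal reached,
`0` for an infinite play. -/
noncomputable def tCost (E : V → V → Prop) (L : V → ℝ) (s : V → V) (v : V) : ℝ :=
  if Reaches E s v then L (playEnd E s v) else 0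

/-- Effective cost in a positive shortest path game: the total length of the
play if it terminates, `+∞` for an infinite play. -/
noncomputable def spCost (E : V → V → Prop) (l : V → V → ℝ) (s : V → V) (v : V) : EReal :=
  if Reaches E s v then
    (((Finset.range (stopTime E s v)).sum fun k => l (s^[k] v) (s^[k+1] v) : ℝ) : EReal)
  else ⊤

/-- Edge-symmetry: every move can be reversed, except moves entering terminals. -/
def EdgeSymm (E : V → V → Prop) : Prop :=
  ∀ u v, E u v → ¬ Terminal E v → E v u

end CoreDefs
section UniformDefs

variable {V : Type}

/-- `s` is a situation in which player `i`'s strategy is a uniform best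
response to the opponents' strategies: no unilateral deviation of `i`
improves `i`'s cost from any initial position. -/
def UBR {n : ℕ} (E : V → V → Prop) (owner : V → Fin n) (L : Fin n → V → ℝ)
    (i : Fin n) (s : V → V) : Prop :=
  ∀ s', IsSituation E s' → Deviation E owner i s s' →
    ∀ v, tCost E (L i) s v ≤ tCost E (L i) s' v

/-- `s'` is obtained from `s` by a uniform best improvement of player `i`. -/
def UBI {n : ℕ} (E : V → V → Prop) (owner : V → Fin n) (L : Fin n → V → ℝ)
    (i : Fin n) (s s' : V → V) : Prop :=
  IsSituation E s' ∧ Deviation E owner i s s' ∧ s' ≠ s ∧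
  UBR E owner L i s' ∧
  ∀ v, owner v = i → ¬ Terminal E v →
    s' v = s v ∨ tCost E (L i) s' v < tCost E (L i) s v

/-- `s` is `i`-basic: every position `v` with a terminal out-neighbour `w`
either uses the terminal move, or every uniform best improvement of player `i`
gives the owner of `v` a strictly better value at `v` than that terminal. -/
def IBasic {n : ℕ} (E : V → V → Prop) (owner : V → Fin n) (L : Fin n → V → ℝ)
    (i : Fin n) (s : V → V) : Prop :=
  ∀ v w, E v w → Terminal E w →
    s v = w ∨ ∀ s', UBI E owner L i s s' → tCost E (L (owner v)) s' v < L (owner v) w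

/-- (S1): every edge between two distinct non-terminal vertices joins positions
of different players. -/
def CondS1 {n : ℕ} (E : V → V → Prop) (owner : V → Fin n) : Prop :=
  ∀ u v, E u v → u ≠ v → ¬ Terminal E u → ¬ Terminal E v → owner u ≠ owner v

/-- (S2): every position has at most one terminal out-neighbour. -/
def CondS2 (E : V → V → Prop) : Prop :=
  ∀ v w w', E v w → E v w' → Terminal E w → Terminal E w' → w = w'

/-- (S3): a terminal position is reachable from every position. -/
def CondS3 (E : V → V → Prop) : Prop :=
  ∀ v : V, ∃ w, Terminal E w ∧ Relation.ReflTransGen E v w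

/-- Uniform Nash equilibrium: a situation that is a Nash equilibrium for every
choice of the initial position. -/
def IsUNE {n : ℕ} (E : V → V → Prop) (owner : V → Fin n) (L : Fin n → V → ℝ)
    (s : V → V) : Prop :=
  IsSituation E s ∧ ∀ i s', IsSituation E s' → Deviation E owner i s s' →
    ∀ v, tCost E (L i) s v ≤ tCost E (L i) s' v

end UniformDefs

section TerminalCost

variable {V : Type}

theorem tCost_congr_terminal {E E' : V → V → Prop}
    (h : ∀ u, Terminal E u ↔ Terminal E' u) (L : V → ℝ) (s : V → V) (u : V) :
    tCost E L s u = tCost E' L s u := by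
  have hT : Terminal E = Terminal E' := funext fun u => propext (h u)
  have hR : Reaches E s u = Reaches E' s u := by simp only [Reaches, hT]
  have hP : playEnd E s u = playEnd E' s u := by simp only [playEnd, stopTime, hT]
  simp only [tCost, hR, hP]

theorem stopTime_of_terminal {E : V → V → Prop} {u : V} (h : Terminal E u) (s : V → V) :
    stopTime E s u = 0 :=
  Nat.sInf_eq_zero.2 (Or.inl h)

theorem tCost_of_terminal {E : V → V → Prop} {u : V} (h : Terminal E u) (L : V → ℝ)
    (s : V → V) : tCost E L s u = L u := by
  have hr : Reaches E s u := ⟨0, h⟩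
  simp [tCost, hr, playEnd, stopTime_of_terminal h]

theorem reaches_step_iff {E : V → V → Prop} {u : V} (h : ¬ Terminal E u) (s : V → V) :
    Reaches E s (s u) ↔ Reaches E s u := by
  constructor
  · rintro ⟨k, hk⟩
    exact ⟨k + 1, hk⟩
  · rintro ⟨_ | k, hk⟩
    · exact absurd hk h
    · exact ⟨k, hk⟩

theorem stopTime_step {E : V → V → Prop} {s : V → V} {u : V} (h : ¬ Terminal E u)
    (hr : Reaches E s u) : stopTime E s u = stopTime E s (s u) + 1 := by
  have hpos : 1 ≤ stopTime E s u := by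
    rw [Nat.one_le_iff_ne_zero]
    intro h0
    have hmem : Terminal E (s^[stopTime E s u] u) := Nat.sInf_mem hr
    rw [h0] at hmem
    exact h hmem
  exact (Nat.sInf_add (p := fun k => Terminal E (s^[k] u)) hpos).symm

/-- The effective cost is constant along a play. -/
theorem tCost_step {E : V → V → Prop} {u : V} (h : ¬ Terminal E u) (L : V → ℝ)
    (s : V → V) : tCost E L s u = tCost E L s (s u) := by
  by_cases hr : Reaches E s u
  · have hr' := (reaches_step_iff h s).2 hr
    simp only [tCost, hr, hr', if_true, playEnd, stopTime_step h hr,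
      Function.iterate_succ_apply]
  · have hr' := mt (reaches_step_iff h s).1 hr
    simp only [tCost, hr, hr', if_false]

theorem tCost_eq_of_reaches {E : V → V → Prop} {L : V → ℝ} {s t : V → V}
    (h : ∀ u, ¬ Terminal E u →
      s u = t u ∨ (Terminal E (s u) ∧ Terminal E (t u) ∧ L (s u) = L (t u)))
    {u : V} (hr : Reaches E s u) : Reaches E t u ∧ tCost E L s u = tCost E L t u := by
  obtain ⟨k, hk⟩ := hr
  induction k generalizing u with
  | zero =>
    exact ⟨⟨0, hk⟩, (tCost_of_terminal hk L s).trans (tCost_of_terminal hk L t).symm⟩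
  | succ k ih =>
    by_cases hu : Terminal E u
    · exact ⟨⟨0, hu⟩, (tCost_of_terminal hu L s).trans (tCost_of_terminal hu L t).symm⟩
    rw [← reaches_step_iff hu t, tCost_step hu, tCost_step hu]
    rcases h u hu with heq | ⟨hs, ht, hL⟩
    · rw [← heq]
      exact ih hk
    · rw [tCost_of_terminal hs, tCost_of_terminal ht]
      exact ⟨⟨0, ht⟩, hL⟩

/-- Exchanging terminal moves for terminal moves of equal cost does not change
the effective cost. -/
theorem tCost_eq_of_terminal_exchange {E : V → V → Prop} {L : V → ℝ} {s t : V → V}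
    (h : ∀ u, ¬ Terminal E u →
      s u = t u ∨ (Terminal E (s u) ∧ Terminal E (t u) ∧ L (s u) = L (t u))) (u : V) :
    tCost E L s u = tCost E L t u := by
  by_cases hs : Reaches E s u
  · exact (tCost_eq_of_reaches h hs).2
  by_cases ht : Reaches E t u
  · refine ((tCost_eq_of_reaches (fun w hw => ?_) ht).2).symm
    exact (h w hw).imp Eq.symm fun ⟨h₁, h₂, h₃⟩ => ⟨h₂, h₁, h₃.symm⟩
  simp only [tCost, hs, ht, if_false]

theorem terminal_delete_edge_iff {E : V → V → Prop} {v x y : V} (hvx : E v x)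
    (hxy : x ≠ y) (u : V) :
    Terminal (fun a b => E a b ∧ ¬(a = v ∧ b = y)) u ↔ Terminal E u := by
  constructor
  · intro h w hw
    by_cases hc : u = v ∧ w = y
    · exact h x ⟨hc.1 ▸ hvx, fun hx => hxy hx.2⟩
    · exact h w ⟨hw, hc⟩
  · exact fun h w hw => h w hw.1

end TerminalCost

/-- Let `Γ = (G, v₀, 𝓛)` be an edge-symmetric terminal game
and `v` a position with two distinct terminal out-neighbours `x, y`.
(a) If `𝓛^{i(v)}(x) < 𝓛^{i(v)}(y)`, then no uniform Nash equilibrium `σ` of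
`Γ` has `σ(v) = y`.
(b) If `𝓛^{i(v)}(x) = 𝓛^{i(v)}(y)` and `σ'` is a uniform Nash equilibrium of
the game `Γ'` obtained from `Γ` by deleting the edge `(v, y)`, then `σ'` is a
uniform Nash equilibrium of `Γ`. -/
theorem redundant_terminal_move
    {V : Type} [Fintype V] {n : ℕ}
    (E : V → V → Prop) (owner : V → Fin n) (L : Fin n → V → ℝ) (v0 : V)
    (hT : ∃ w, Terminal E w)        -- the set of terminals is nonempty
    (hv0 : ¬ Terminal E v0)         -- the initial position is not terminal
    (hsym : EdgeSymm E)             -- the game is edge-symmetric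
    (v x y : V)
    (hvx : E v x) (hvy : E v y)     -- `x`, `y` are out-neighbours of `v`
    (hx : Terminal E x) (hy : Terminal E y)
    (hxy : x ≠ y) :
    ((L (owner v) x < L (owner v) y →
        ∀ s, IsUNE E owner L s → s v ≠ y) ∧
     (L (owner v) x = L (owner v) y →
        ∀ s, IsUNE (fun a b => E a b ∧ ¬(a = v ∧ b = y)) owner L s →
          IsUNE E owner L s)) := by
  have hv : ¬ Terminal E v := fun h => h x hvx
  constructor
  · rintro hlt s ⟨hs, hNE⟩ hsv
    have hle := hNE (owner v) (Function.update s v x)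
      (fun u hu => by
        by_cases huv : u = v
        · subst huv
          simpa using hvx
        · simpa [huv] using hs u hu)
      (fun u hu => by
        have huv : u ≠ v := by
          rintro rfl
          exact hu.elim (fun h => h rfl) hv
        simp [huv]) v
    rw [tCost_step hv, tCost_step hv, Function.update_self, hsv, tCost_of_terminal hx,
      tCost_of_terminal hy] at hle
    exact absurd hle (not_le.2 hlt)
  · rintro heq s ⟨hs, hNE⟩
    have hterm := terminal_delete_edge_iff hvx hxy
    simp only [IsSituation, Deviation, hterm, tCost_congr_terminal hterm] at hs hNE
    refine ⟨fun u hu => (hs u hu).1, fun i s' hs' hdev u => ?_⟩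
    by_cases hsv : s' v = y
    · have hi : owner v = i := by
        by_contra hne
        exact (hs v hv).2 ⟨rfl, (hdev v (Or.inl hne)).symm.trans hsv⟩
      subst hi
      refine (hNE (owner v) (Function.update s' v x) ?_ ?_ u).trans_eq
        (tCost_eq_of_terminal_exchange ?_ u)
      · intro w hw
        by_cases hwv : w = v
        · subst hwv
          simpa using ⟨hvx, hxy⟩
        · simpa [hwv] using hs' w hw
      · intro w hw
        have hwv : w ≠ v := by
          rintro rfl
          exact hw.elim (fun h => h rfl) hv
        simpa [hwv] using hdev w hw
      · intro w _
        by_cases hwv : w = v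
        · subst hwv
          rw [Function.update_self, hsv]
          exact Or.inr ⟨hx, hy, heq⟩
        · exact Or.inl (Function.update_of_ne hwv _ _)
    · refine hNE i s' (fun w hw => ⟨hs' w hw, ?_⟩) hdev u
      rintro ⟨rfl, hw'⟩
      exact hsv hw'
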